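/- arXiv:2006.15462 — 2 statements merged into one kernel-verified Lean document; each statement's English description precedes it below -/
import Mathlib

section
/- Let w₁, w₂ be binary words of length ℓ with normalized Hamming distance d = d(w₁,w₂) > 0. Let m ∈ ℕ, let n = mℓ, and let C be the set of all 2^m words of length n obtained by concatenating m blocks, each block equal to w₁ or w₂. Let ε, θ > 0 satisfy 2ε/d + 1/m ≤ 1/2. If v₁, …, v_k are words of length n such that the ε-balls B_ε(v₁), …, B_ε(v_k) (in normalized Hamming distance) together contain at least (1 − θ)·2^m of the words of C, then k ≥ (1 − θ)·2^{m(1 − 𝓗(2ε/d + 1/m))}. -/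
open MeasureTheory Filter Set
open scoped symmDiff ENNReal

namespace SlowEntropyPaper

variable {X : Type*}

/-- A finite measurable partition of `X` indexed by `Fin r`. -/
def IsPartition [MeasurableSpace X] {r : ℕ} (P : Fin r → Set X) : Prop :=
  (∀ i, MeasurableSet (P i)) ∧
  (∀ i j : Fin r, i ≠ j → Disjoint (P i) (P j)) ∧
  (⋃ i, P i) = Set.univ

/-- A finite partition is nontrivial if it has at least two elements of positive measure. -/
def NontrivialPartition [MeasurableSpace X] (μ : Measure X) {r : ℕ} (P : Fin r → Set X) :
    Prop :=
  ∃ i j : Fin r, i ≠ j ∧ 0 < μ (P i) ∧ 0 < μ (P j)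

open scoped Classical in
/-- The number of positions `0 ≤ i < n` at which the `P`-name of `x` under `T`
(the word whose `i`-th letter is the index `j` with `T^i x ∈ P j`) differs from
the word `v`. -/
noncomputable def mismatch (T : X → X) {r : ℕ} (P : Fin r → Set X) (n : ℕ)
    (v : Fin n → Fin r) (x : X) : ℕ :=
  (Finset.univ.filter (fun i : Fin n => T^[(i : ℕ)] x ∉ P (v i))).card

/-- The `ε`-Hamming ball `B_ε^{T,P}(v)`: points whose `P`-name of length `n` is within
normalized Hamming distance `ε` of the word `v`. -/
def hamBall (T : X → X) {r : ℕ} (P : Fin r → Set X) (n : ℕ) (v : Fin n → Fin r)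
    (ε : ℝ) : Set X :=
  {x | (mismatch T P n v x : ℝ) < ε * n}

/-- `S_P(T,n,ε,δ)`: the minimal number of `ε`-Hamming balls whose union has
measure at least `1 - δ`. -/
noncomputable def coverNum [MeasurableSpace X] (μ : Measure X) (T : X → X) {r : ℕ}
    (P : Fin r → Set X) (n : ℕ) (ε δ : ℝ) : ℕ :=
  sInf {k : ℕ | ∃ v : Fin k → (Fin n → Fin r),
    ENNReal.ofReal (1 - δ) ≤ μ (⋃ i, hamBall T P n (v i) ε)}

/-- A rate function: positive, monotone in `t`, and tending to `∞` for each `t > 0`. -/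
def IsRateFunction (a : ℕ → ℝ → ℝ) : Prop :=
  (∀ n t, 0 < t → 0 < a n t) ∧
  (∀ n s t, 0 < s → s < t → a n s ≤ a n t) ∧
  (∀ t, 0 < t → Tendsto (fun n => a n t) atTop atTop)

/-- A subexponential rate function. -/
def IsSubexponential (a : ℕ → ℝ → ℝ) : Prop :=
  IsRateFunction a ∧
  ∀ t β : ℝ, 0 < t → 1 < β → Tendsto (fun n => a n t / β ^ n) atTop (nhds 0)

/-- Upper slow entropy of `T` with respect to the rate `a` and the partition `P`:
`lim_{δ→0⁺} lim_{ε→0⁺} sup {t > 0 : limsup_n S_P(T,n,ε,δ)/a_n(t) > 0}` (as a value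
in `ℝ≥0∞`, with `sup ∅ = 0`; the limits are suprema by monotonicity). -/
noncomputable def upperSlowEntropyPart [MeasurableSpace X] (μ : Measure X) (T : X → X)
    (a : ℕ → ℝ → ℝ) {r : ℕ} (P : Fin r → Set X) : ℝ≥0∞ :=
  ⨆ (δ : ℝ) (_ : 0 < δ), ⨆ (ε : ℝ) (_ : 0 < ε),
    sSup (ENNReal.ofReal '' {t : ℝ | 0 < t ∧
      0 < Filter.limsup
        (fun n => (coverNum μ T P n ε δ : ℝ≥0∞) / ENNReal.ofReal (a n t)) Filter.atTop})

/-- Lower slow entropy of `T` with respect to the rate `a` and the partition `P`. -/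
noncomputable def lowerSlowEntropyPart [MeasurableSpace X] (μ : Measure X) (T : X → X)
    (a : ℕ → ℝ → ℝ) {r : ℕ} (P : Fin r → Set X) : ℝ≥0∞ :=
  ⨆ (δ : ℝ) (_ : 0 < δ), ⨆ (ε : ℝ) (_ : 0 < ε),
    sSup (ENNReal.ofReal '' {t : ℝ | 0 < t ∧
      0 < Filter.liminf
        (fun n => (coverNum μ T P n ε δ : ℝ≥0∞) / ENNReal.ofReal (a n t)) Filter.atTop})

/-- Upper slow entropy of `T`: supremum over all finite measurable partitions. -/
noncomputable def upperSlowEntropy [MeasurableSpace X] (μ : Measure X) (T : X → X)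
    (a : ℕ → ℝ → ℝ) : ℝ≥0∞ :=
  ⨆ (r : ℕ) (P : Fin r → Set X) (_ : IsPartition P), upperSlowEntropyPart μ T a P

/-- Lower slow entropy of `T`: supremum over all finite measurable partitions. -/
noncomputable def lowerSlowEntropy [MeasurableSpace X] (μ : Measure X) (T : X → X)
    (a : ℕ → ℝ → ℝ) : ℝ≥0∞ :=
  ⨆ (r : ℕ) (P : Fin r → Set X) (_ : IsPartition P), lowerSlowEntropyPart μ T a P

/-- The space `𝓜` of invertible measure-preserving transformations of `(X, μ)`. -/
abbrev MPE [MeasurableSpace X] (μ : Measure X) : Type _ :=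
  {T : X ≃ᵐ X // MeasurePreserving (⇑T) μ μ}

/-- The weak topology on `𝓜`, generated by the sets
`{T : μ(T A Δ T₀ A) < ε}` for `T₀ ∈ 𝓜`, measurable `A` and `ε > 0`. -/
def weakTopology [MeasurableSpace X] (μ : Measure X) : TopologicalSpace (MPE μ) :=
  TopologicalSpace.generateFrom
    {U : Set (MPE μ) | ∃ (T₀ : MPE μ) (A : Set X) (ε : ℝ), MeasurableSet A ∧ 0 < ε ∧
      U = {T : MPE μ | μ (((T.1 : X → X) '' A) ∆ ((T₀.1 : X → X) '' A)) < ENNReal.ofReal ε}}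

/-- `T` is rigid: there is a sequence `n_k → ∞` with `μ(T^{n_k} A Δ A) → 0` for all
measurable `A`. -/
def Rigid [MeasurableSpace X] (μ : Measure X) (T : X → X) : Prop :=
  ∃ nk : ℕ → ℕ, Tendsto nk atTop atTop ∧
    ∀ A : Set X, MeasurableSet A →
      Tendsto (fun k => μ ((T^[nk k] '' A) ∆ A)) atTop (nhds 0)

/-- `T` is weak mixing: Cesàro convergence of `|μ(T^{-n}A ∩ B) - μ(A)μ(B)|` to `0`. -/
def WeakMixing [MeasurableSpace X] (μ : Measure X) (T : X → X) : Prop :=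
  ∀ A B : Set X, MeasurableSet A → MeasurableSet B →
    Tendsto (fun N : ℕ => (1 / (N : ℝ)) * ∑ n ∈ Finset.range N,
      |(μ (T^[n] ⁻¹' A ∩ B)).toReal - (μ A).toReal * (μ B).toReal|) atTop (nhds 0)

/-- `T` is rank-one: every finite partition is approximated by the levels of a single
Rokhlin tower. -/
def RankOne [MeasurableSpace X] (μ : Measure X) (T : X → X) : Prop :=
  ∀ ε : ℝ, 0 < ε → ∀ (r : ℕ) (P : Fin r → Set X), IsPartition P →
    ∃ (B : Set X) (h : ℕ), MeasurableSet B ∧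
      (∀ i j : ℕ, i < h → j < h → i ≠ j → Disjoint (T^[i] '' B) (T^[j] '' B)) ∧
      ENNReal.ofReal (1 - ε) < μ (⋃ i : Fin h, T^[(i : ℕ)] '' B) ∧
      ∀ k : Fin r, ∃ J : Finset (Fin h),
        μ ((P k) ∆ (⋃ j ∈ J, T^[(j : ℕ)] '' B)) < ENNReal.ofReal ε

/-- The atom of the refinement `⋁_{i=0}^{n-1} T^{-i} P` corresponding to the word `w`. -/
def joinAtom (T : X → X) {r : ℕ} (P : Fin r → Set X) (n : ℕ) (w : Fin n → Fin r) :
    Set X :=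
  ⋂ i : Fin n, T^[(i : ℕ)] ⁻¹' P (w i)

/-- `H(⋁_{i=0}^{n-1} T^{-i} P)`: base-2 entropy of the `n`-th refinement of `P`. -/
noncomputable def refinedEntropy [MeasurableSpace X] (μ : Measure X) (T : X → X) {r : ℕ}
    (P : Fin r → Set X) (n : ℕ) : ℝ :=
  -∑ w : Fin n → Fin r,
    (μ (joinAtom T P n w)).toReal * Real.logb 2 (μ (joinAtom T P n w)).toReal

open scoped Classical in
/-- The number of positions `0 ≤ i < n` at which the `P`-name and the `Q`-name of `x`
under `T` differ. -/
noncomputable def nameMismatch (T : X → X) {r : ℕ} (P Q : Fin r → Set X) (n : ℕ)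
    (x : X) : ℕ :=
  (Finset.univ.filter
    (fun i : Fin n => ¬ ∃ j : Fin r, T^[(i : ℕ)] x ∈ P j ∧ T^[(i : ℕ)] x ∈ Q j)).card

open scoped Classical in
/-- Normalized Hamming distance between two words of length `n`. -/
noncomputable def hdist {α : Type*} {n : ℕ} (w w' : Fin n → α) : ℝ :=
  ((Finset.univ.filter (fun i : Fin n => w i ≠ w' i)).card : ℝ) / n

/-- The concatenation of `m` blocks, the `j`-th block being `w₁` or `w₂` according to
`c j`. -/
def concatWord {ℓ : ℕ} (w₁ w₂ : Fin ℓ → Bool) (m : ℕ) (c : Fin m → Bool) :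
    Fin (m * ℓ) → Bool := fun i =>
  if h : ℓ = 0 then false
  else
    (if c ⟨(i : ℕ) / ℓ, Nat.div_lt_of_lt_mul (lt_of_lt_of_eq i.isLt (Nat.mul_comm m ℓ))⟩
      then w₁ else w₂)
      ⟨(i : ℕ) % ℓ, Nat.mod_lt _ (Nat.pos_of_ne_zero h)⟩

/-- The binary entropy function (base-2 logarithm). -/
noncomputable def H2 (x : ℝ) : ℝ :=
  -(x * Real.logb 2 x) - (1 - x) * Real.logb 2 (1 - x)

/-- A sublinear sequence of positive reals. -/
def Sublinear (a : ℕ → ℝ) : Prop :=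
  (∀ n, 0 < a n) ∧ Tendsto a atTop atTop ∧
    Tendsto (fun n => a n / n) atTop (nhds 0)

lemma hdist_eq_hammingDist_div {α : Type*} [DecidableEq α] {n : ℕ} (w w' : Fin n → α) :
    hdist w w' = (hammingDist w w' : ℝ) / n := by
  unfold hdist hammingDist
  congr!

lemma hdist_triangle_right {α : Type*} {n : ℕ} (x y z : Fin n → α) :
    hdist x y ≤ hdist x z + hdist y z := by
  classical
  simp only [hdist_eq_hammingDist_div]
  rw [← add_div]
  gcongr
  exact_mod_cast hammingDist_triangle_right x y z

lemma concatWord_finProdFinEquiv {ℓ m : ℕ} (w₁ w₂ : Fin ℓ → Bool) (c : Fin m → Bool)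
    (j : Fin m) (r : Fin ℓ) :
    concatWord w₁ w₂ m c (finProdFinEquiv (j, r)) = if c j then w₁ r else w₂ r := by
  have hl : 0 < ℓ := r.pos
  have hdiv : ((r : ℕ) + ℓ * j) / ℓ = j := by
    rw [Nat.add_mul_div_left _ _ hl, Nat.div_eq_of_lt r.isLt, zero_add]
  have hmod : ((r : ℕ) + ℓ * j) % ℓ = r := by
    rw [Nat.add_mul_mod_self_left, Nat.mod_eq_of_lt r.isLt]
  simp only [concatWord, hl.ne', dite_false, finProdFinEquiv_apply_val, hdiv, hmod, Fin.eta]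
  split_ifs <;> rfl

lemma hammingDist_concatWord {ℓ m : ℕ} (w₁ w₂ : Fin ℓ → Bool) (c c' : Fin m → Bool) :
    hammingDist (concatWord w₁ w₂ m c) (concatWord w₁ w₂ m c') =
      hammingDist c c' * hammingDist w₁ w₂ := by
  unfold hammingDist
  rw [← Finset.card_product]
  symm
  refine Finset.card_equiv finProdFinEquiv ?_
  rintro ⟨j, r⟩
  simp only [Finset.mem_product, Finset.mem_filter, Finset.mem_univ, true_and,
    concatWord_finProdFinEquiv]
  cases c j <;> cases c' j <;> simp [eq_comm]

lemma hdist_concatWord {ℓ m : ℕ} (w₁ w₂ : Fin ℓ → Bool) (c c' : Fin m → Bool) :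
    hdist (concatWord w₁ w₂ m c) (concatWord w₁ w₂ m c') = hdist c c' * hdist w₁ w₂ := by
  simp only [hdist_eq_hammingDist_div, hammingDist_concatWord, Nat.cast_mul]
  rw [mul_div_mul_comm]

lemma rpow_neg_mul_H2 (m : ℕ) {p : ℝ} (hp₀ : 0 < p) (hp₁ : p < 1) :
    (2 : ℝ) ^ (-((m : ℝ) * H2 p)) = p ^ (p * m) * (1 - p) ^ ((1 - p) * m) := by
  have hq : 0 < 1 - p := sub_pos.2 hp₁
  have hexp : -((m : ℝ) * H2 p) =
      Real.logb 2 p * (p * m) + Real.logb 2 (1 - p) * ((1 - p) * m) := by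
    unfold H2; ring
  rw [hexp, Real.rpow_add two_pos, Real.rpow_mul two_pos.le, Real.rpow_mul two_pos.le,
    Real.rpow_logb two_pos (by norm_num) hp₀, Real.rpow_logb two_pos (by norm_num) hq]

lemma prod_ite_eq_pow_hammingDist {m : ℕ} (p : ℝ) (c c₀ : Fin m → Bool) :
    ∏ j, (if c j ≠ c₀ j then p else 1 - p) =
      p ^ hammingDist c c₀ * (1 - p) ^ (m - hammingDist c c₀) := by
  rw [Finset.prod_ite, Finset.prod_const, Finset.prod_const]
  congr 2
  have h := Finset.card_filter_add_card_filter_not (s := (Finset.univ : Finset (Fin m)))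
    (fun j => c j ≠ c₀ j)
  rw [Finset.card_univ, Fintype.card_fin] at h
  unfold hammingDist
  omega

lemma sum_prod_ite_eq_one {m : ℕ} (p : ℝ) (c₀ : Fin m → Bool) :
    ∑ c : Fin m → Bool, ∏ j, (if c j ≠ c₀ j then p else 1 - p) = 1 := by
  have h := Finset.prod_univ_sum (fun _ : Fin m => (Finset.univ : Finset Bool))
    (fun j b => if b ≠ c₀ j then p else 1 - p)
  rw [Fintype.piFinset_univ] at h
  rw [← h]
  refine Finset.prod_eq_one fun j _ => ?_
  cases c₀ j <;> simp

lemma rpow_neg_mul_H2_le_prod_ite {m : ℕ} {p : ℝ} (hp₀ : 0 < p) (hp : p ≤ 1 / 2)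
    (c c₀ : Fin m → Bool) (hc : (hammingDist c c₀ : ℝ) ≤ p * m) :
    (2 : ℝ) ^ (-((m : ℝ) * H2 p)) ≤ ∏ j, (if c j ≠ c₀ j then p else 1 - p) := by
  have hq : 0 < 1 - p := by linarith
  have hD : hammingDist c c₀ ≤ m := by
    simpa using hammingDist_le_card_fintype (x := c) (y := c₀)
  rw [rpow_neg_mul_H2 m hp₀ (by linarith), prod_ite_eq_pow_hammingDist,
    ← Real.rpow_natCast, ← Real.rpow_natCast, Nat.cast_sub hD]
  set D : ℝ := (hammingDist c c₀ : ℝ)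
  have hsplit₁ : p ^ (p * m) = p ^ D * p ^ (p * m - D) := by
    rw [← Real.rpow_add hp₀]; ring_nf
  have hsplit₂ : (1 - p) ^ ((m : ℝ) - D) = (1 - p) ^ (p * m - D) * (1 - p) ^ ((1 - p) * m) := by
    rw [← Real.rpow_add hq]; ring_nf
  rw [hsplit₁, hsplit₂, mul_assoc]
  gcongr
  linarith

/-- The entropy bound on the cardinality of a Hamming ball in the Boolean cube. -/
lemma ncard_hammingBall_le {m : ℕ} {p : ℝ} (hp₀ : 0 < p) (hp : p ≤ 1 / 2)
    (c₀ : Fin m → Bool) :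
    (({c : Fin m → Bool | (hammingDist c c₀ : ℝ) ≤ p * m}).ncard : ℝ) ≤
      (2 : ℝ) ^ ((m : ℝ) * H2 p) := by
  classical
  have hq : 0 < 1 - p := by linarith
  rw [Set.ncard_eq_toFinset_card']
  set s := ({c : Fin m → Bool | (hammingDist c c₀ : ℝ) ≤ p * m}).toFinset with hs
  have hle : (s.card : ℝ) * (2 : ℝ) ^ (-((m : ℝ) * H2 p)) ≤ 1 := by
    rw [← sum_prod_ite_eq_one p c₀, ← nsmul_eq_mul]
    refine (Finset.card_nsmul_le_sum s _ _ fun c hc => ?_).trans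
      (Finset.sum_le_univ_sum_of_nonneg fun c => Finset.prod_nonneg fun j _ => ?_)
    · exact rpow_neg_mul_H2_le_prod_ite hp₀ hp c c₀ (by simpa [hs] using hc)
    · split_ifs <;> linarith
  rwa [Real.rpow_neg two_pos.le, ← div_eq_mul_inv, div_le_one (by positivity)] at hle

lemma ncard_concatWord_ball_le {ℓ m : ℕ} (hm : 0 < m) (w₁ w₂ : Fin ℓ → Bool)
    (hd : 0 < hdist w₁ w₂) {ε p : ℝ} (hp₀ : 0 < p) (hp : p ≤ 1 / 2)
    (hε : 2 * ε / hdist w₁ w₂ ≤ p) (v : Fin (m * ℓ) → Bool) :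
    (({c : Fin m → Bool | hdist (concatWord w₁ w₂ m c) v < ε}).ncard : ℝ) ≤
      (2 : ℝ) ^ ((m : ℝ) * H2 p) := by
  rcases Set.eq_empty_or_nonempty {c : Fin m → Bool | hdist (concatWord w₁ w₂ m c) v < ε}
    with h | ⟨c₀, hc₀⟩
  · rw [h, Set.ncard_empty, Nat.cast_zero]
    positivity
  refine le_trans ?_ (ncard_hammingBall_le hp₀ hp c₀)
  refine Nat.cast_le.2 (Set.ncard_le_ncard (fun c hc => ?_) (Set.toFinite _))
  simp only [Set.mem_ofPred_eq] at hc hc₀ ⊢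
  have htri := hdist_triangle_right (concatWord w₁ w₂ m c) (concatWord w₁ w₂ m c₀) v
  rw [hdist_concatWord] at htri
  have hle : hdist c c₀ ≤ p := by
    refine le_trans ?_ hε
    rw [le_div_iff₀ hd]
    linarith
  rwa [hdist_eq_hammingDist_div, div_le_iff₀ (by exact_mod_cast hm)] at hle

/-- a lower bound on the number of `ε`-Hamming balls needed to cover
`(1-θ)·2^m` of the `2^m` concatenations of two fixed blocks `w₁, w₂`. -/
theorem statement10 {ℓ m : ℕ} (hl : 0 < ℓ) (hm : 0 < m)
    (w₁ w₂ : Fin ℓ → Bool) (d : ℝ) (hwd : hdist w₁ w₂ = d) (hd : 0 < d)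
    (ε θ : ℝ) (hε : 0 < ε) (hθ : 0 < θ)
    (hcond : 2 * ε / d + 1 / (m : ℝ) ≤ 1 / 2)
    (k : ℕ) (v : Fin k → (Fin (m * ℓ) → Bool))
    (hcover : (1 - θ) * 2 ^ m ≤
      (({c : Fin m → Bool | ∃ i, hdist (concatWord w₁ w₂ m c) (v i) < ε}).ncard : ℝ)) :
    (1 - θ) * (2 : ℝ) ^ ((m : ℝ) * (1 - H2 (2 * ε / d + 1 / (m : ℝ)))) ≤ (k : ℝ) := by
  subst hwd
  set p : ℝ := 2 * ε / hdist w₁ w₂ + 1 / (m : ℝ)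
  have hm' : (0 : ℝ) < m := by exact_mod_cast hm
  have hp₀ : 0 < p := by positivity
  have hεp : 2 * ε / hdist w₁ w₂ ≤ p := le_add_of_nonneg_right (by positivity)
  have hunion : {c : Fin m → Bool | ∃ i, hdist (concatWord w₁ w₂ m c) (v i) < ε} =
      ⋃ i, {c : Fin m → Bool | hdist (concatWord w₁ w₂ m c) (v i) < ε} := by
    ext c; simp
  have hcard : (({c : Fin m → Bool | ∃ i, hdist (concatWord w₁ w₂ m c) (v i) < ε}).ncard : ℝ) ≤
      k * (2 : ℝ) ^ ((m : ℝ) * H2 p) := by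
    rw [hunion]
    calc ((⋃ i, {c : Fin m → Bool | hdist (concatWord w₁ w₂ m c) (v i) < ε}).ncard : ℝ)
        ≤ ∑ i, (({c : Fin m → Bool | hdist (concatWord w₁ w₂ m c) (v i) < ε}).ncard : ℝ) := by
          exact_mod_cast Set.ncard_iUnion_le_of_fintype _
      _ ≤ ∑ _i : Fin k, (2 : ℝ) ^ ((m : ℝ) * H2 p) :=
          Finset.sum_le_sum fun i _ =>
            ncard_concatWord_ball_le hm w₁ w₂ hd hp₀ hcond hεp (v i)
      _ = k * (2 : ℝ) ^ ((m : ℝ) * H2 p) := by simp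
  rw [mul_sub, mul_one, Real.rpow_sub two_pos, Real.rpow_natCast, ← mul_div_assoc,
    div_le_iff₀ (by positivity)]
  exact hcover.trans hcard

end SlowEntropyPaper
end

section
/- Let (X, ℬ, μ, T) be an invertible measure-preserving system on a probability space, let η > 0 and r, n ∈ ℕ, and let b be a set of positive measure such that b, Tb, …, T^{n−1}b are pairwise disjoint modulo null sets; put b̂ = ⋃_{i=0}^{n−1} T^i b. Suppose P = {p₁, …, p_r} and Q = {q₁, …, q_r} are measurable partitions of X such that Σ_{i=1}^r μ((pᵢ ∩ b̂) Δ (qᵢ ∩ b̂)) < η²·μ(b̂). Then μ({x ∈ b : d(P⃗ₙ(x), Q⃗ₙ(x)) < η}) > (1 − η)·μ(b). -/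
open MeasureTheory Filter Set
open scoped symmDiff ENNReal

namespace SlowEntropyPaper

variable {X : Type*}

/-- The set of points at which the partitions `P` and `Q` assign different indices. -/
def disagreement {r : ℕ} (P Q : Fin r → Set X) : Set X :=
  {y | ¬ ∃ j : Fin r, y ∈ P j ∧ y ∈ Q j}

lemma measurableSet_disagreement [MeasurableSpace X] {r : ℕ} {P Q : Fin r → Set X}
    (hP : ∀ i, MeasurableSet (P i)) (hQ : ∀ i, MeasurableSet (Q i)) :
    MeasurableSet (disagreement P Q) := by
  have h : disagreement P Q = (⋃ j, P j ∩ Q j)ᶜ := by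
    ext y
    simp [disagreement]
  rw [h]
  exact (MeasurableSet.iUnion fun j => (hP j).inter (hQ j)).compl

lemma measure_inter_disagreement_le [MeasurableSpace X] (μ : Measure X) {r : ℕ}
    {P : Fin r → Set X} (Q : Fin r → Set X) (hP : ⋃ i, P i = univ) (S : Set X) :
    μ (S ∩ disagreement P Q) ≤ ∑ i, μ ((P i ∩ S) ∆ (Q i ∩ S)) := by
  refine (measure_mono ?_).trans (measure_iUnion_fintype_le μ _)
  rintro y ⟨hyS, hyD⟩
  obtain ⟨i, hi⟩ := mem_iUnion.1 (hP ▸ mem_univ y : y ∈ ⋃ i, P i)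
  exact mem_iUnion.2 ⟨i, Or.inl ⟨⟨hi, hyS⟩, fun h => hyD ⟨i, hi, h.1⟩⟩⟩

lemma nameMismatch_le (T : X → X) {r : ℕ} (P Q : Fin r → Set X) (n : ℕ) (x : X) :
    nameMismatch T P Q n x ≤ n := by
  classical
  exact (Finset.card_le_univ _).trans_eq (Fintype.card_fin n)

lemma nameMismatch_eq_sum_indicator (T : X → X) {r : ℕ} (P Q : Fin r → Set X) (n : ℕ) (x : X) :
    (nameMismatch T P Q n x : ℝ≥0∞) =
      ∑ i : Fin n, (T^[(i : ℕ)] ⁻¹' disagreement P Q).indicator 1 x := by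
  classical
  simp [nameMismatch, indicator_apply, disagreement]

lemma measurableEmbedding_iterate [MeasurableSpace X] (T : X ≃ᵐ X) (i : ℕ) :
    MeasurableEmbedding (⇑T)^[i] := by
  induction i with
  | zero => exact MeasurableEmbedding.id
  | succ k ih => exact ih.comp T.measurableEmbedding

lemma measure_iterate_image_inter [MeasurableSpace X] {μ : Measure X} {T : X ≃ᵐ X}
    (hT : MeasurePreserving (⇑T) μ μ) (i : ℕ) (b D : Set X) :
    μ ((⇑T)^[i] '' b ∩ D) = μ (b ∩ (⇑T)^[i] ⁻¹' D) := by
  rw [← (hT.iterate i).measure_preimage_emb (measurableEmbedding_iterate T i), preimage_inter,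
    preimage_image_eq _ (measurableEmbedding_iterate T i).injective]

/-- On a tower with almost disjoint levels, the integral over the base of the number of
mismatches is the measure of the part of the tower on which the partitions disagree. -/
lemma setLIntegral_nameMismatch [MeasurableSpace X] {μ : Measure X} {T : X ≃ᵐ X}
    (hT : MeasurePreserving (⇑T) μ μ) {r n : ℕ} {b : Set X} (hb : MeasurableSet b)
    (hdisj : ∀ i j : ℕ, i < n → j < n → i ≠ j → μ ((⇑T)^[i] '' b ∩ (⇑T)^[j] '' b) = 0)
    {P Q : Fin r → Set X} (hP : ∀ i, MeasurableSet (P i)) (hQ : ∀ i, MeasurableSet (Q i)) :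
    ∫⁻ x in b, nameMismatch (⇑T) P Q n x ∂μ =
      μ ((⋃ j : Fin n, (⇑T)^[(j : ℕ)] '' b) ∩ disagreement P Q) := by
  have hD := measurableSet_disagreement hP hQ
  have hpre (i : Fin n) : MeasurableSet ((⇑T)^[(i : ℕ)] ⁻¹' disagreement P Q) :=
    (T.measurable.iterate i) hD
  rw [iUnion_inter, measure_iUnion₀, tsum_fintype]
  · simp_rw [nameMismatch_eq_sum_indicator]
    rw [lintegral_finsetSum _ fun i _ => measurable_one.indicator (hpre i)]
    refine Finset.sum_congr rfl fun i _ => ?_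
    rw [lintegral_indicator_one (hpre i), Measure.restrict_apply (hpre i),
      measure_iterate_image_inter hT, inter_comm]
  · intro i j hij
    exact measure_mono_null (inter_subset_inter inter_subset_left inter_subset_left)
      (hdisj i j i.isLt j.isLt (Fin.val_ne_of_ne hij))
  · exact fun i =>
      (((measurableEmbedding_iterate T i).measurableSet_image.2 hb).inter hD).nullMeasurableSet

lemma measurable_nameMismatch [MeasurableSpace X] {T : X → X} (hT : Measurable T) {r n : ℕ}
    {P Q : Fin r → Set X} (hP : ∀ i, MeasurableSet (P i)) (hQ : ∀ i, MeasurableSet (Q i)) :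
    Measurable fun x => (nameMismatch T P Q n x : ℝ≥0∞) := by
  simp_rw [nameMismatch_eq_sum_indicator]
  exact Finset.measurable_fun_sum _ fun i _ =>
    measurable_one.indicator ((hT.iterate i) (measurableSet_disagreement hP hQ))

lemma measure_iUnion_iterate_image_le [MeasurableSpace X] {μ : Measure X} {T : X ≃ᵐ X}
    (hT : MeasurePreserving (⇑T) μ μ) (n : ℕ) (b : Set X) :
    μ (⋃ j : Fin n, (⇑T)^[(j : ℕ)] '' b) ≤ n * μ b := by
  refine (measure_iUnion_fintype_le μ _).trans_eq ?_
  have h (i : ℕ) : μ ((⇑T)^[i] '' b) = μ b := by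
    simpa using measure_iterate_image_inter hT i b univ
  simp [h]

/-- if two partitions agree up to `η²μ(b̂)` on a Rokhlin tower
`b̂ = ⋃_{i<n} T^i b` with pairwise disjoint levels (mod null), then on more than a
`(1-η)`-fraction of the base `b` the `P`-name and the `Q`-name of length `n` are
`η`-close in normalized Hamming distance. -/
theorem statement12 {X : Type*} [MeasurableSpace X]
    (μ : Measure X) [IsProbabilityMeasure μ]
    (T : X ≃ᵐ X) (hT : MeasurePreserving (⇑T) μ μ)
    (η : ℝ) (hη : 0 < η) (r n : ℕ) (hn : 0 < n)
    (b : Set X) (hb : MeasurableSet b) (hb0 : 0 < μ b)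
    (hdisj : ∀ i j : ℕ, i < n → j < n → i ≠ j →
      μ ((⇑T)^[i] '' b ∩ (⇑T)^[j] '' b) = 0)
    (P Q : Fin r → Set X) (hP : IsPartition P) (hQ : IsPartition Q)
    (hPQ : ∑ i : Fin r,
        μ ((P i ∩ ⋃ j : Fin n, (⇑T)^[(j : ℕ)] '' b) ∆
           (Q i ∩ ⋃ j : Fin n, (⇑T)^[(j : ℕ)] '' b))
      < ENNReal.ofReal (η ^ 2) * μ (⋃ j : Fin n, (⇑T)^[(j : ℕ)] '' b)) :
    ENNReal.ofReal (1 - η) * μ b <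
      μ {x ∈ b | (nameMismatch (⇑T) P Q n x : ℝ) < η * n} := by
  have hmeas := measurable_nameMismatch (n := n) T.measurable hP.1 hQ.1
  have hiff (x : X) : ENNReal.ofReal (η * n) ≤ nameMismatch (⇑T) P Q n x ↔
      η * n ≤ nameMismatch (⇑T) P Q n x := by
    rw [← ENNReal.ofReal_natCast, ENNReal.ofReal_le_ofReal_iff (Nat.cast_nonneg _)]
  rcases lt_or_ge 1 η with hη1 | hη1
  · have hgood : {x ∈ b | (nameMismatch (⇑T) P Q n x : ℝ) < η * n} = b := by
      refine sep_eq_self_iff_mem_true.2 fun x _ => ?_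
      have h₁ : (nameMismatch (⇑T) P Q n x : ℝ) ≤ n := by
        exact_mod_cast nameMismatch_le (⇑T) P Q n x
      have h₂ : (0 : ℝ) < n := by exact_mod_cast hn
      nlinarith
    rw [hgood, ENNReal.ofReal_of_nonpos (by linarith), zero_mul]
    exact hb0
  set bad : Set X := {x | ENNReal.ofReal (η * n) ≤ nameMismatch (⇑T) P Q n x} with hbad_def
  have hbadm : MeasurableSet bad := measurableSet_le measurable_const hmeas
  have hgood : {x ∈ b | (nameMismatch (⇑T) P Q n x : ℝ) < η * n} = b \ bad := by
    ext x
    simp only [mem_ofPred_eq, Set.mem_sdiff, hbad_def, hiff, not_le]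
  have hbad : μ (b ∩ bad) < ENNReal.ofReal η * μ b := by
    have hlt : ENNReal.ofReal (η * n) * μ (b ∩ bad) <
        ENNReal.ofReal (η * n) * (ENNReal.ofReal η * μ b) := by
      calc ENNReal.ofReal (η * n) * μ (b ∩ bad)
          = ENNReal.ofReal (η * n) * μ.restrict b bad := by
            rw [Measure.restrict_apply hbadm, inter_comm]
        _ ≤ ∫⁻ x in b, nameMismatch (⇑T) P Q n x ∂μ :=
            mul_meas_ge_le_lintegral hmeas _
        _ = μ ((⋃ j : Fin n, (⇑T)^[(j : ℕ)] '' b) ∩ disagreement P Q) :=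
            setLIntegral_nameMismatch hT hb hdisj hP.1 hQ.1
        _ ≤ _ := measure_inter_disagreement_le μ Q hP.2.2 _
        _ < ENNReal.ofReal (η ^ 2) * μ (⋃ j : Fin n, (⇑T)^[(j : ℕ)] '' b) := hPQ
        _ ≤ ENNReal.ofReal (η ^ 2) * (n * μ b) := by
            gcongr
            exact measure_iUnion_iterate_image_le hT n b
        _ = ENNReal.ofReal (η * n) * (ENNReal.ofReal η * μ b) := by
            rw [ENNReal.ofReal_mul hη.le, ENNReal.ofReal_natCast, ENNReal.ofReal_pow hη.le]
            ring
    exact lt_of_mul_lt_mul_left' hlt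
  rw [hgood]
  have hsplit : ENNReal.ofReal (1 - η) * μ b + ENNReal.ofReal η * μ b = μ b := by
    rw [← add_mul, ← ENNReal.ofReal_add (by linarith) hη.le]
    simp
  by_contra! hle
  have hfin : ENNReal.ofReal (1 - η) * μ b ≠ ∞ :=
    ENNReal.mul_ne_top ENNReal.ofReal_ne_top (measure_ne_top μ b)
  have hcontra : μ b < μ b := by
    calc μ b = μ (b \ bad) + μ (b ∩ bad) := (measure_sdiff_add_inter b hbadm).symm
      _ ≤ ENNReal.ofReal (1 - η) * μ b + μ (b ∩ bad) := by gcongr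
      _ < ENNReal.ofReal (1 - η) * μ b + ENNReal.ofReal η * μ b :=
          ENNReal.add_lt_add_left hfin hbad
      _ = μ b := hsplit
  exact lt_irrefl _ hcontra

end SlowEntropyPaper
end
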